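/- For all x = (x₁,x₂) ∈ V the following symmetries hold: if the (common) rotor sequence is circular, then maxcon((x₁,x₂)) = −mincon((−x₁,x₂)); if it is x-alternating, then maxcon((x₁,x₂)) = −mincon((−x₁,x₂)); if it is y-alternating, then maxcon((x₁,x₂)) = −mincon((x₁,−x₂)). -/

import Mathlib

open Finset

/-- Vertices: we work on `ℤ × ℤ`; the grid `V` consists of points with
`x₁ ≡ x₂ (mod 2)`. -/
abbrev Vtx : Type := ℤ × ℤ

/-- The four diagonal directions. -/
def DIRset : Finset Vtx := {(1,1), (1,-1), (-1,-1), (-1,1)}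

/-- Membership in `V`: both coordinates have the same parity. -/
def inV (x : Vtx) : Prop := x.1 % 2 = x.2 % 2

/-- `H x t`: probability that a random-walk chip starting at `x` is at the
origin after `t` steps. -/
noncomputable def H (x : Vtx) (t : ℕ) : ℝ :=
  if x.1 % 2 = (t : ℤ) % 2 ∧ x.2 % 2 = (t : ℤ) % 2 ∧ |x.1| ≤ (t : ℤ) ∧ |x.2| ≤ (t : ℤ) then
    (4 : ℝ) ^ (-(t : ℤ)) * (Nat.choose t (((t : ℤ) + x.1) / 2).toNat)
      * (Nat.choose t (((t : ℤ) + x.2) / 2).toNat)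
  else 0

/-- `INF x A t := H (x+A) (t-1) - H x t`, for `t ≥ 1`. -/
noncomputable def INF (x A : Vtx) (t : ℕ) : ℝ := H (x + A) (t - 1) - H x t

/-- A rotor sequence: a cyclic permutation of the four directions. -/
def IsRotorSequence (next : Vtx → Vtx) : Prop :=
  ∀ A ∈ DIRset, ({A, next A, next^[2] A, next^[3] A} : Finset Vtx) = DIRset

/-- One step of the Propp machine: a vertex holding `k` chips and rotor `d`
sends chip `i` (for `i = 0, …, k-1`) to `x + next^[i] d` and sets its rotor
to `next^[k] d`. -/
def proppStep (next : Vtx → Vtx) (st : (Vtx → ℕ) × (Vtx → Vtx)) :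
    (Vtx → ℕ) × (Vtx → Vtx) :=
  (fun y => ∑ A ∈ DIRset,
      ((Finset.range (st.1 (y - A))).filter (fun i => next^[i] (st.2 (y - A)) = A)).card,
   fun x => next^[st.1 x] (st.2 x))

/-- The Propp machine after `t` steps: chip counts and rotor directions. -/
def propp (next : Vtx → Vtx) (f0 : Vtx → ℕ) (arr0 : Vtx → Vtx) :
    ℕ → (Vtx → ℕ) × (Vtx → Vtx)
  | 0 => (f0, arr0)
  | t + 1 => proppStep next (propp next f0 arr0 t)

/-- An initial configuration is even if chips lie only on vertices `x ~ 0`. -/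
def EvenConfig (f0 : Vtx → ℕ) : Prop :=
  ∀ x : Vtx, ¬(x.1 % 2 = 0 ∧ x.2 % 2 = 0) → f0 x = 0

/-- The linear machine: each vertex sends a quarter of its chips to each
neighbor. -/
noncomputable def lin (f0 : Vtx → ℕ) : ℕ → Vtx → ℝ
  | 0 => fun x => (f0 x : ℝ)
  | t + 1 => fun x => (1/4) * ∑ A ∈ DIRset, lin f0 t (x + A)

/-- `sTime … x i`: the first time `u` with `i < ∑_{t=0}^{u} f(x,t)`, i.e. the
time at which `x` is occupied by its `i`-th chip. -/
noncomputable def sTime (next : Vtx → Vtx) (f0 : Vtx → ℕ) (arr0 : Vtx → Vtx)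
    (x : Vtx) (i : ℕ) : ℕ :=
  sInf {u : ℕ | i < ∑ t ∈ Finset.range (u + 1), (propp next f0 arr0 t).1 x}

/-- The contribution of vertex `x` for run-time `T`.  The chips with
`s_i(x) < T` are exactly those with `i < ∑_{t=0}^{T-1} f(x,t)`. -/
noncomputable def con (next : Vtx → Vtx) (f0 : Vtx → ℕ) (arr0 : Vtx → Vtx)
    (x : Vtx) (T : ℕ) : ℝ :=
  ∑ i ∈ Finset.range (∑ t ∈ Finset.range T, (propp next f0 arr0 t).1 x),
    INF x (next^[i] (arr0 x)) (T - sTime next f0 arr0 x i)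

/-- `maxcon next x`: supremum of `con` over all even initial configurations
(with rotors pointing in directions of `DIRset`) and all run-times. -/
noncomputable def maxcon (next : Vtx → Vtx) (x : Vtx) : ℝ :=
  sSup {c : ℝ | ∃ f0 arr0 T, EvenConfig f0 ∧ (∀ y : Vtx, arr0 y ∈ DIRset) ∧
    c = con next f0 arr0 x T}

/-- `mincon next x`: infimum of `con` over all even initial configurations
(with rotors pointing in directions of `DIRset`) and all run-times. -/
noncomputable def mincon (next : Vtx → Vtx) (x : Vtx) : ℝ :=
  sInf {c : ℝ | ∃ f0 arr0 T, EvenConfig f0 ∧ (∀ y : Vtx, arr0 y ∈ DIRset) ∧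
    c = con next f0 arr0 x T}

def NE : Vtx := (1, 1)
def SE : Vtx := (1, -1)
def SW : Vtx := (-1, -1)
def NW : Vtx := (-1, 1)

/-- Circular rotor sequences: `(NE,SE,SW,NW)` or `(NE,NW,SW,SE)`. -/
def Circular (next : Vtx → Vtx) : Prop :=
  (next NE = SE ∧ next^[2] NE = SW ∧ next^[3] NE = NW) ∨
  (next NE = NW ∧ next^[2] NE = SW ∧ next^[3] NE = SE)

/-- `x`-alternating rotor sequences: `(NE,NW,SE,SW)` or `(NE,SW,SE,NW)`. -/
def XAlternating (next : Vtx → Vtx) : Prop :=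
  (next NE = NW ∧ next^[2] NE = SE ∧ next^[3] NE = SW) ∨
  (next NE = SW ∧ next^[2] NE = SE ∧ next^[3] NE = NW)

/-- `y`-alternating rotor sequences: `(NE,SE,NW,SW)` or `(NE,SW,NW,SE)`. -/
def YAlternating (next : Vtx → Vtx) : Prop :=
  (next NE = SE ∧ next^[2] NE = NW ∧ next^[3] NE = SW) ∨
  (next NE = SW ∧ next^[2] NE = NW ∧ next^[3] NE = SE)


/-! Rotor sequence facts -/

lemma next_mem {next : Vtx → Vtx} (h : IsRotorSequence next) {A : Vtx} (hA : A ∈ DIRset) :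
    next A ∈ DIRset := by
  have := h A hA
  rw [← this]; simp

lemma iter_mem {next : Vtx → Vtx} (h : IsRotorSequence next) {A : Vtx} (hA : A ∈ DIRset) (n : ℕ) :
    next^[n] A ∈ DIRset := by
  induction n with
  | zero => simpa using hA
  | succ n ih => rw [Function.iterate_succ_apply']; exact next_mem h ih

lemma dir_card : DIRset.card = 4 := by decide

lemma distinct4 {a b c d : Vtx} (h : ({a, b, c, d} : Finset Vtx) = DIRset) :
    a ≠ b ∧ a ≠ c ∧ a ≠ d ∧ b ≠ c ∧ b ≠ d ∧ c ≠ d := by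
  have h4 : ({a, b, c, d} : Finset Vtx).card = 4 := by rw [h]; exact dir_card
  have k3 : ∀ u v w : Vtx, ({u, v, w} : Finset Vtx).card ≤ 3 := fun u v w => Finset.card_le_three
  refine ⟨?_, ?_, ?_, ?_, ?_, ?_⟩ <;> rintro rfl
  · have := k3 a c d; simp at h4; omega
  · have := k3 a b d; have e : ({a, b, a, d} : Finset Vtx) = {a, b, d} := by ext; simp; tauto
    rw [e] at h4; omega
  · have := k3 a b c; have e : ({a, b, c, a} : Finset Vtx) = {a, b, c} := by ext; simp; tauto
    rw [e] at h4; omega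
  · have := k3 a b d; have e : ({a, b, b, d} : Finset Vtx) = {a, b, d} := by ext; simp
    rw [e] at h4; omega
  · have := k3 a b c; have e : ({a, b, c, b} : Finset Vtx) = {a, b, c} := by ext; simp; tauto
    rw [e] at h4; omega
  · have := k3 a b c; have e : ({a, b, c, c} : Finset Vtx) = {a, b, c} := by ext; simp
    rw [e] at h4; omega

lemma next_four {next : Vtx → Vtx} (h : IsRotorSequence next) {A : Vtx} (hA : A ∈ DIRset) :
    next (next (next (next A))) = A := by
  have h1 := h A hA
  have h2 := distinct4 (h _ (next_mem h hA))
  have h3 : next (next (next (next A))) ∈ DIRset := iter_mem h hA 4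
  rw [← h1] at h3
  simp only [Function.iterate_succ, Function.iterate_zero, Function.comp, id, Finset.mem_insert,
    Finset.mem_singleton] at h2 h3
  rcases h3 with h3 | h3 | h3 | h3
  · exact h3
  · exact absurd h3.symm h2.2.2.1
  · exact absurd h3.symm h2.2.2.2.2.1
  · exact absurd h3.symm h2.2.2.2.2.2

lemma iter_add_four {next : Vtx → Vtx} (h : IsRotorSequence next) {A : Vtx} (hA : A ∈ DIRset)
    (n : ℕ) : next^[n + 4] A = next^[n] A := by
  rw [Function.iterate_add_apply]
  congr 1
  exact next_four h hA

lemma sum_four {next : Vtx → Vtx} (h : IsRotorSequence next) {A : Vtx} (hA : A ∈ DIRset)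
    {M : Type*} [AddCommMonoid M] (F : Vtx → M) :
    ∑ j ∈ range 4, F (next^[j] A) = ∑ B ∈ DIRset, F B := by
  have hd := distinct4 (h A hA)
  rw [← h A hA, Finset.sum_insert, Finset.sum_insert, Finset.sum_insert, Finset.sum_singleton]
  · simp [Finset.sum_range_succ, add_assoc]
  · simpa using hd.2.2.2.2.2
  · simp only [mem_insert, mem_singleton]; tauto
  · simp only [mem_insert, mem_singleton]; tauto

/-! The kernel -/

noncomputable def h1 (a : ℤ) (t : ℕ) : ℝ :=
  if a % 2 = (t : ℤ) % 2 ∧ |a| ≤ (t : ℤ) then (Nat.choose t (((t : ℤ) + a) / 2).toNat : ℝ) else 0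

lemma H_eq (x : Vtx) (t : ℕ) : H x t = (4 : ℝ) ^ (-(t : ℤ)) * h1 x.1 t * h1 x.2 t := by
  unfold H h1
  split_ifs <;> first | rfl | (simp; done) | (exfalso; tauto)

lemma h1_neg (a : ℤ) (t : ℕ) : h1 (-a) t = h1 a t := by
  unfold h1
  have e : (-a % 2 = (t : ℤ) % 2 ∧ |-a| ≤ (t : ℤ)) ↔ (a % 2 = (t : ℤ) % 2 ∧ |a| ≤ (t : ℤ)) := by
    rw [abs_neg]; constructor <;> rintro ⟨h, h'⟩ <;> exact ⟨by omega, h'⟩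
  simp only [e]
  split_ifs with hh
  · obtain ⟨p, q⟩ := hh
    rw [abs_le] at q
    congr 1
    apply Nat.choose_symm_of_eq_add
    omega
  · rfl

lemma h1_succ (a : ℤ) (t : ℕ) : h1 a (t + 1) = h1 (a + 1) t + h1 (a - 1) t := by
  unfold h1
  simp only [abs_le]
  by_cases hp : a % 2 = ((t + 1 : ℕ) : ℤ) % 2
  swap
  · rw [if_neg (by tauto), if_neg (by push_cast at hp; omega), if_neg (by push_cast at hp; omega)]
    simp
  push_cast at hp
  by_cases hb : -((t : ℤ) + 1) ≤ a ∧ a ≤ (t : ℤ) + 1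
  swap
  · rw [if_neg (by push_cast; tauto), if_neg (by omega), if_neg (by omega)]
    simp
  rw [if_pos (by push_cast; omega)]
  rcases eq_or_ne a (-((t : ℤ) + 1)) with he | he
  · rw [if_pos (by omega), if_neg (by omega)]
    have e1 : ((((t + 1 : ℕ) : ℤ) + a) / 2).toNat = 0 := by omega
    have e2 : (((t : ℤ) + (a + 1)) / 2).toNat = 0 := by omega
    rw [e1, e2]; simp
  rcases eq_or_ne a (((t : ℤ) + 1)) with he' | he'
  · rw [if_neg (by omega), if_pos (by omega)]
    have e1 : ((((t + 1 : ℕ) : ℤ) + a) / 2).toNat = t + 1 := by omega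
    have e2 : (((t : ℤ) + (a - 1)) / 2).toNat = t := by omega
    rw [e1, e2]; simp
  rw [if_pos (by omega), if_pos (by omega)]
  obtain ⟨m, hm⟩ : ∃ m : ℕ, (((t : ℤ) + (a - 1)) / 2).toNat = m := ⟨_, rfl⟩
  have e1 : ((((t + 1 : ℕ) : ℤ) + a) / 2).toNat = m + 1 := by omega
  have e2 : (((t : ℤ) + (a + 1)) / 2).toNat = m + 1 := by omega
  rw [e1, e2, hm, Nat.choose_succ_succ]
  push_cast; ring

lemma sum_dir {M : Type*} [AddCommMonoid M] (F : Vtx → M) :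
    ∑ B ∈ DIRset, F B = F (1,1) + (F (1,-1) + (F (-1,-1) + F (-1,1))) := by
  unfold DIRset
  rw [Finset.sum_insert (by decide), Finset.sum_insert (by decide), Finset.sum_insert (by decide),
    Finset.sum_singleton]

lemma INF_sum (x : Vtx) (t : ℕ) (ht : 0 < t) : ∑ B ∈ DIRset, INF x B t = 0 := by
  obtain ⟨s, rfl⟩ : ∃ s, t = s + 1 := ⟨t - 1, by omega⟩
  rw [sum_dir]
  simp only [INF, H_eq, h1_succ, Prod.fst_add, Prod.snd_add, Nat.add_sub_cancel]
  have e : (4 : ℝ) ^ (-(s : ℤ)) = 4 * (4 : ℝ) ^ (-((s + 1 : ℕ) : ℤ)) := by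
    push_cast
    rw [neg_add, zpow_add₀ (by norm_num)]; norm_num; ring
  rw [e]
  simp only [← sub_eq_add_neg]
  ring

/-! The combinatorial identity -/

lemma per_mod (P : ℕ → ℝ) (h : ∀ n, P (n + 4) = P n) (a b : ℕ) (hab : a % 4 = b % 4) :
    P a = P b := by
  have : ∀ q r, P (r + 4 * q) = P r := by
    intro q r
    induction q with
    | zero => simp
    | succ q ih => rw [← ih, ← h (r + 4 * q)]; congr 1
  rw [← Nat.mod_add_div a 4, ← Nat.mod_add_div b 4, this, this, hab]

lemma key_identity (G : ℕ → ℝ) (hG : ∀ n, G (n + 4) = G n) (h0 : ∑ j ∈ range 4, G j = 0)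
    (N N' k k' : ℕ) (hN : (N + N') % 4 = 0) (hk : (k + k') % 4 = 0) :
    ∑ j ∈ range k, G (N + j) = - ∑ j ∈ range k', G (3 * (N' + j + 1)) := by
  set P : ℕ → ℝ := fun n => ∑ i ∈ range n, G i with hP
  have hPs : ∀ n, P (n + 1) = P n + G n := fun n => Finset.sum_range_succ _ _
  have hPp : ∀ n, P (n + 4) = P n := by
    intro n
    induction n with
    | zero => simpa [hP] using h0
    | succ n ih => 
      have := hPs (n + 4)
      rw [show n + 1 + 4 = n + 4 + 1 by ring, this, ih, hG, hPs]
  have e1 : ∀ k, ∑ j ∈ range k, G (N + j) = P (N + k) - P N := by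
    intro k
    induction k with
    | zero => simp
    | succ k ih => rw [Finset.sum_range_succ, ih, ← add_assoc, hPs]; ring
  have e2 : ∀ k, ∑ j ∈ range k, G (3 * (N' + j + 1)) = P (3 * N') - P (3 * (N' + k)) := by
    intro k
    induction k with
    | zero => simp
    | succ k ih =>
      rw [Finset.sum_range_succ, ih]
      have a := hPs (3 * (N' + k + 1))
      have b := hPp (3 * (N' + k))
      rw [show 3 * (N' + k + 1) + 1 = 3 * (N' + k) + 4 by ring] at a
      rw [show 3 * (N' + (k + 1)) = 3 * (N' + k + 1) by ring]
      linarith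
  rw [e1, e2, per_mod P hPp (3 * N') N (by omega), per_mod P hPp (3 * (N' + k')) (N + k) (by omega)]
  ring

/-! Rewriting con -/

lemma con_eq (next : Vtx → Vtx) (f0 : Vtx → ℕ) (arr0 : Vtx → Vtx) (x : Vtx) (T : ℕ) :
    con next f0 arr0 x T = ∑ t ∈ range T, ∑ j ∈ range ((propp next f0 arr0 t).1 x),
      INF x (next^[(∑ s ∈ range t, (propp next f0 arr0 s).1 x) + j] (arr0 x)) (T - t) := by
  unfold con
  have key : ∀ S, ∑ i ∈ Finset.range (∑ t ∈ Finset.range S, (propp next f0 arr0 t).1 x),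
    INF x (next^[i] (arr0 x)) (T - sTime next f0 arr0 x i) = 
    ∑ t ∈ range S, ∑ j ∈ range ((propp next f0 arr0 t).1 x),
      INF x (next^[(∑ s ∈ range t, (propp next f0 arr0 s).1 x) + j] (arr0 x)) (T - t) := by
    intro S
    induction S with
    | zero => simp
    | succ S ih =>
      rw [Finset.sum_range_succ (fun t => (propp next f0 arr0 t).1 x), Finset.sum_range_add, ih,
        Finset.sum_range_succ]
      congr 1
      apply Finset.sum_congr rfl
      intro j hj
      congr 2
      unfold sTime
      apply le_antisymm
      · apply Nat.sInf_le
        simp only [Set.mem_ofPred_eq, Finset.sum_range_succ]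
        have := Finset.mem_range.1 hj
        omega
      · apply le_csInf
        · refine ⟨S, ?_⟩
          simp only [Set.mem_ofPred_eq, Finset.sum_range_succ]
          have := Finset.mem_range.1 hj
          omega
        · intro u hu
          by_contra hlt
          have hle : u + 1 ≤ S := by omega
          have : ∑ t ∈ range (u + 1), (propp next f0 arr0 t).1 x
              ≤ ∑ t ∈ range S, (propp next f0 arr0 t).1 x :=
            Finset.sum_le_sum_of_subset (Finset.range_mono hle)
          simp only [Set.mem_ofPred_eq] at hu
          omega
  exact key T

/-! Forcing -/

lemma propp_parity (next : Vtx → Vtx) (f0 : Vtx → ℕ) (arr0 : Vtx → Vtx) (he : EvenConfig f0)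
    (t : ℕ) (y : Vtx) (hy : ¬(y.1 % 2 = (t : ℤ) % 2 ∧ y.2 % 2 = (t : ℤ) % 2)) :
    (propp next f0 arr0 t).1 y = 0 := by
  induction t generalizing y with
  | zero => exact he y (by simpa using hy)
  | succ t ih =>
    simp only [propp, proppStep]
    apply Finset.sum_eq_zero
    intro A hA
    rw [ih (y - A)]
    · simp
    · intro hc
      apply hy
      simp only [DIRset, mem_insert, mem_singleton] at hA
      push_cast
      rcases hA with rfl | rfl | rfl | rfl <;> simp at hc <;> omega

def walk (g : Vtx → ℕ) : Vtx → ℕ := fun y => ∑ A ∈ DIRset, g (y - A)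

lemma card_filter_add {next : Vtx → Vtx} (h : IsRotorSequence next) {a : Vtx} (ha : a ∈ DIRset)
    {A : Vtx} (hA : A ∈ DIRset) (k m : ℕ) :
    ((range (k + 4 * m)).filter (fun i => next^[i] a = A)).card
      = ((range k).filter (fun i => next^[i] a = A)).card + m := by
  simp only [Finset.card_filter]
  induction m with
  | zero => simp
  | succ m ih =>
    rw [show k + 4 * (m + 1) = (k + 4 * m) + 4 by ring, Finset.sum_range_add, ih, add_assoc]
    congr 2
    have := sum_four h (iter_mem h ha (k + 4 * m)) (fun B => if B = A then 1 else 0)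
    rw [Finset.sum_ite_eq' DIRset A, if_pos hA] at this
    refine Eq.trans ?_ this
    apply Finset.sum_congr rfl
    intro j _
    rw [add_comm, Function.iterate_add_apply]

lemma iter_add_mul {next : Vtx → Vtx} (h : IsRotorSequence next) {a : Vtx} (ha : a ∈ DIRset)
    (k m : ℕ) : next^[k + 4 * m] a = next^[k] a := by
  induction m with
  | zero => simp
  | succ m ih => rw [← ih, ← iter_add_four h ha (k + 4 * m)]; congr 1

lemma step_add {next : Vtx → Vtx} (h : IsRotorSequence next) (f g : Vtx → ℕ) (a : Vtx → Vtx)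
    (ha : ∀ y, a y ∈ DIRset) :
    proppStep next (fun y => f y + 4 * g y, a) =
      (fun y => (proppStep next (f, a)).1 y + walk g y, (proppStep next (f, a)).2) := by
  unfold proppStep walk
  ext1
  · funext y
    simp only
    rw [← Finset.sum_add_distrib]
    exact Finset.sum_congr rfl fun A hA => card_filter_add h (ha _) hA _ _
  · funext y
    exact iter_add_mul h (ha _) _ _

lemma propp_arr {next : Vtx → Vtx} (h : IsRotorSequence next) (f0 : Vtx → ℕ) (a : Vtx → Vtx)
    (ha : ∀ y, a y ∈ DIRset) (t : ℕ) : ∀ y, (propp next f0 a t).2 y ∈ DIRset := by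
  induction t with
  | zero => exact ha
  | succ t ih => intro y; exact iter_mem h (ih y) _

lemma walk_mul (c : ℕ) (g : Vtx → ℕ) : walk (fun y => c * g y) = fun y => c * walk g y := by
  funext y; simp [walk, Finset.mul_sum]

lemma propp_add {next : Vtx → Vtx} (h : IsRotorSequence next) (f0 D : Vtx → ℕ) (a : Vtx → Vtx)
    (ha : ∀ y, a y ∈ DIRset) (T s r : ℕ) (hs : s + r = T) :
    propp next (fun y => f0 y + 4 ^ T * D y) a s =
      (fun y => (propp next f0 a s).1 y + 4 ^ r * (walk^[s] D) y, (propp next f0 a s).2) := by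
  induction s generalizing r with
  | zero => simp at hs; subst hs; rfl
  | succ s ih =>
    rw [propp, ih (r + 1) (by omega)]
    have := step_add h (propp next f0 a s).1 (fun y => 4 ^ r * (walk^[s] D) y) (propp next f0 a s).2
      (propp_arr h f0 a ha s)
    simp only [pow_succ']
    simp only [mul_assoc]
    rw [this, walk_mul, Function.iterate_succ_apply']
    rfl

lemma walk_zero (D : Vtx → ℕ) (z : Vtx) (hD : ∀ y, D y ≠ 0 → z.1 ≤ y.1) (s : ℕ) :
    ∀ y : Vtx, y.1 < z.1 - s → (walk^[s] D) y = 0 := by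
  induction s with
  | zero => intro y hy; by_contra hc; have := hD y hc; simp at hy; omega
  | succ s ih =>
    intro y hy
    rw [Function.iterate_succ_apply', walk]
    apply Finset.sum_eq_zero
    intro A hA
    apply ih
    simp only [DIRset, mem_insert, mem_singleton] at hA
    push_cast at hy
    rcases hA with rfl | rfl | rfl | rfl <;> simp <;> omega

lemma walk_zero2 (D : Vtx → ℕ) (z : Vtx) (hD : ∀ y, D y ≠ 0 → z.2 ≤ y.2) (s : ℕ) :
    ∀ y : Vtx, y.2 < z.2 - s → (walk^[s] D) y = 0 := by
  induction s with
  | zero => intro y hy; by_contra hc; have := hD y hc; simp at hy; omega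
  | succ s ih =>
    intro y hy
    rw [Function.iterate_succ_apply', walk]
    apply Finset.sum_eq_zero
    intro A hA
    apply ih
    simp only [DIRset, mem_insert, mem_singleton] at hA
    push_cast at hy
    rcases hA with rfl | rfl | rfl | rfl <;> simp <;> omega

lemma walk_corner (D : Vtx → ℕ) (z : Vtx) (hD : ∀ y, D y ≠ 0 → y = z) (s : ℕ) :
    (walk^[s] D) (z.1 - s, z.2 - s) = D z := by
  have hD1 : ∀ y, D y ≠ 0 → z.1 ≤ y.1 := fun y hy => by rw [hD y hy]
  have hD2 : ∀ y, D y ≠ 0 → z.2 ≤ y.2 := fun y hy => by rw [hD y hy]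
  induction s with
  | zero => simp
  | succ s ih =>
    rw [Function.iterate_succ_apply', walk, sum_dir]
    rw [walk_zero D z hD1 s (_ - (1,1)) (by simp; omega),
      walk_zero D z hD1 s (_ - (1,-1)) (by simp; omega),
      walk_zero2 D z hD2 s (_ - (-1,1)) (by simp; omega), ← ih]
    have hv : ((z.1 - ((s + 1 : ℕ) : ℤ), z.2 - ((s + 1 : ℕ) : ℤ)) : Vtx) - (-1, -1)
        = (z.1 - s, z.2 - s) := by
      apply Prod.ext <;> simp <;> ring
    rw [hv]
    simp only [zero_add, add_zero]

lemma forcing {next : Vtx → Vtx} (h : IsRotorSequence next) (x : Vtx) (a : Vtx → Vtx)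
    (ha : ∀ y, a y ∈ DIRset) (k : ℕ → ℕ)
    (hk : ∀ t : ℕ, ¬(x.1 % 2 = (t : ℤ) % 2 ∧ x.2 % 2 = (t : ℤ) % 2) → k t % 4 = 0) (T : ℕ) :
    ∃ f0, EvenConfig f0 ∧ ∀ t < T, (propp next f0 a t).1 x % 4 = k t % 4 := by
  induction T with
  | zero => exact ⟨fun _ => 0, fun _ _ => rfl, by simp⟩
  | succ T ih =>
    obtain ⟨f0, he, hf⟩ := ih
    by_cases hp : x.1 % 2 = (T : ℤ) % 2 ∧ x.2 % 2 = (T : ℤ) % 2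
    · set z : Vtx := (x.1 + T, x.2 + T) with hz
      set e := k T + 3 * (propp next f0 a T).1 x with hedef
      set D : Vtx → ℕ := fun y => if y = z then e else 0 with hDdef
      have hD : ∀ y, D y ≠ 0 → y = z := by
        intro y hy; by_contra hc; exact hy (by simp [hDdef, hc])
      refine ⟨fun y => f0 y + 4 ^ T * D y, ?_, ?_⟩
      · intro y hy
        have : D y = 0 := by
          by_contra hc
          have := hD y hc
          apply hy
          rw [this, hz]
          simp only
          omega
        simp [he y hy, this]
      · intro t ht
        rw [propp_add h f0 D a ha T t (T - t) (by omega)]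
        simp only
        rcases Nat.lt_succ_iff_lt_or_eq.1 ht with hlt | rfl
        · rw [walk_zero D z (fun y hy => by rw [hD y hy]) t x (by simp [hz]; omega)]
          simpa using hf t hlt
        · have := walk_corner D z hD t
          have hx : ((z.1 - t, z.2 - t) : Vtx) = x := by ext <;> simp [hz]
          rw [hx] at this
          rw [this]
          simp [hDdef]
          omega
    · refine ⟨f0, he, ?_⟩
      intro t ht
      rcases Nat.lt_succ_iff_lt_or_eq.1 ht with hlt | rfl
      · exact hf t hlt
      · rw [propp_parity next f0 a he t x hp, hk t hp]

/-! Main -/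

lemma iter_reflect {next : Vtx → Vtx} (h : IsRotorSequence next) (R : Vtx → Vtx)
    (hR : ∀ A ∈ DIRset, next (R (next A)) = R A) {a : Vtx} (ha : a ∈ DIRset) (n : ℕ) :
    next^[n] (R (next^[3] a)) = R (next^[3 * (n + 1)] a) := by
  induction n with
  | zero => rfl
  | succ n ih =>
    rw [Function.iterate_succ_apply', ih, ← iter_add_four h ha (3 * (n + 1)),
      show 3 * (n + 1) + 4 = 3 * (n + 1 + 1) + 1 by ring, Function.iterate_succ_apply',
      hR _ (iter_mem h ha _)]

def conSet (next : Vtx → Vtx) (x : Vtx) : Set ℝ :=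
  {c : ℝ | ∃ f0 arr0 T, EvenConfig f0 ∧ (∀ y : Vtx, arr0 y ∈ DIRset) ∧
    c = con next f0 arr0 x T}

lemma conSet_sub {next : Vtx → Vtx} (h : IsRotorSequence next) (R : Vtx → Vtx)
    (hR : ∀ A ∈ DIRset, next (R (next A)) = R A) (hRd : ∀ A ∈ DIRset, R A ∈ DIRset)
    (hRI : ∀ x A t, INF (R x) (R A) t = INF x A t)
    (hRp : ∀ (x : Vtx), (R x).1 % 2 = x.1 % 2 ∧ (R x).2 % 2 = x.2 % 2)
    (x : Vtx) (c : ℝ) (hc : c ∈ conSet next x) : -c ∈ conSet next (R x) := by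
  obtain ⟨f0, a, T, he, ha, rfl⟩ := hc
  obtain ⟨f1, he1, hf1⟩ := forcing h (R x) (fun _ => R (next^[3] (a x)))
    (fun _ => hRd _ (iter_mem h (ha x) 3)) (fun t => 3 * (propp next f0 a t).1 x)
    (by
      intro t ht
      rw [(hRp x).1, (hRp x).2] at ht
      simp [propp_parity next f0 a he t x ht]) T
  refine ⟨f1, fun _ => R (next^[3] (a x)), T, he1, fun _ => hRd _ (iter_mem h (ha x) 3), ?_⟩
  rw [con_eq, con_eq, ← Finset.sum_neg_distrib]
  have hN : ∀ t ≤ T, (∑ s ∈ range t, (propp next f0 a s).1 x +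
      ∑ s ∈ range t, (propp next f1 (fun _ => R (next^[3] (a x))) s).1 (R x)) % 4 = 0 := by
    intro t
    induction t with
    | zero => simp
    | succ t ih =>
      intro ht
      have h1 := ih (by omega)
      have h2 := hf1 t (by omega)
      rw [Finset.sum_range_succ, Finset.sum_range_succ]
      omega
  apply Finset.sum_congr rfl
  intro t ht
  have ht := Finset.mem_range.1 ht
  have h2 := hf1 t ht
  have := key_identity (fun n => INF x (next^[n] (a x)) (T - t))
    (fun n => by simp only [iter_add_four h (ha x)])
    (by
      rw [sum_four h (ha x) (fun B => INF x B (T - t))]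
      exact INF_sum x _ (by omega))
    _ _ ((propp next f0 a t).1 x)
    ((propp next f1 (fun _ => R (next^[3] (a x))) t).1 (R x)) (hN t ht.le) (by omega)
  rw [this, neg_neg]
  apply Finset.sum_congr rfl
  intro j _
  rw [iter_reflect h R hR (ha x), hRI]

lemma main_sym {next : Vtx → Vtx} (h : IsRotorSequence next) (R : Vtx → Vtx)
    (hR : ∀ A ∈ DIRset, next (R (next A)) = R A) (hRd : ∀ A ∈ DIRset, R A ∈ DIRset)
    (hRI : ∀ x A t, INF (R x) (R A) t = INF x A t)
    (hRp : ∀ (x : Vtx), (R x).1 % 2 = x.1 % 2 ∧ (R x).2 % 2 = x.2 % 2)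
    (hRR : ∀ x, R (R x) = x) (x : Vtx) : maxcon next x = - mincon next (R x) := by
  change sSup (conSet next x) = - sInf (conSet next (R x))
  rw [Real.sInf_def, neg_neg]
  congr 1
  ext c
  rw [Set.mem_neg]
  constructor
  · exact conSet_sub h R hR hRd hRI hRp x c
  · intro hc
    have := conSet_sub h R hR hRd hRI hRp (R x) _ hc
    rwa [hRR, neg_neg] at this

def Rx (x : Vtx) : Vtx := (-x.1, x.2)
def Ry (x : Vtx) : Vtx := (x.1, -x.2)

lemma Rx_INF (x A : Vtx) (t : ℕ) : INF (Rx x) (Rx A) t = INF x A t := by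
  simp only [INF, H_eq, Rx, Prod.fst_add, Prod.snd_add, ← neg_add, h1_neg]

lemma Ry_INF (x A : Vtx) (t : ℕ) : INF (Ry x) (Ry A) t = INF x A t := by
  simp only [INF, H_eq, Ry, Prod.fst_add, Prod.snd_add, ← neg_add, h1_neg]

lemma cyc {next : Vtx → Vtx} (h : IsRotorSequence next) {a b c : Vtx}
    (hn : next NE = a ∧ next^[2] NE = b ∧ next^[3] NE = c) :
    next NE = a ∧ next a = b ∧ next b = c ∧ next c = NE := by
  obtain ⟨h1, h2, h3⟩ := hn
  have h4 := next_four h (A := NE) (by decide)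
  simp only [Function.iterate_succ, Function.iterate_zero, Function.comp, id] at h2 h3
  rw [h3] at h4; rw [h2] at h3; rw [h1] at h2
  exact ⟨h1, h2, h3, h4⟩

lemma rx_main {next : Vtx → Vtx} (h : IsRotorSequence next)
    (hR : ∀ A ∈ DIRset, next (Rx (next A)) = Rx A) (x : Vtx) :
    maxcon next x = - mincon next (-x.1, x.2) :=
  main_sym h Rx hR (by decide) Rx_INF (fun x => by simp [Rx]; try omega)
    (fun x => by simp [Rx]) x

lemma ry_main {next : Vtx → Vtx} (h : IsRotorSequence next)
    (hR : ∀ A ∈ DIRset, next (Ry (next A)) = Ry A) (x : Vtx) :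
    maxcon next x = - mincon next (x.1, -x.2) :=
  main_sym h Ry hR (by decide) Ry_INF (fun x => by simp [Ry]; try omega)
    (fun x => by simp [Ry]) x

/-- Symmetries of `maxcon` and `mincon` depending on the rotor sequence. -/
theorem maxcon_mincon_symmetries (next : Vtx → Vtx) (hnext : IsRotorSequence next)
    (x : Vtx) (hx : inV x) :
    (Circular next → maxcon next (x.1, x.2) = - mincon next (-x.1, x.2)) ∧
    (XAlternating next → maxcon next (x.1, x.2) = - mincon next (-x.1, x.2)) ∧
    (YAlternating next → maxcon next (x.1, x.2) = - mincon next (x.1, -x.2)) := by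
  refine ⟨fun hc => rx_main hnext ?_ x, fun hc => rx_main hnext ?_ x, fun hc => ry_main hnext ?_ x⟩
  all_goals
    rcases hc with hc | hc <;>
    · obtain ⟨c1, c2, c3, c4⟩ := cyc hnext hc
      simp only [NE, SE, SW, NW] at c1 c2 c3 c4
      intro A hA
      simp only [DIRset, mem_insert, mem_singleton] at hA
      rcases hA with rfl | rfl | rfl | rfl <;> simp [Rx, Ry, c1, c2, c3, c4]
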